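/- Let γ = exp(−2πi/3) and Λ the 3×3 matrix with rows (1,−1,0), (0,1,−1), (−1,0,1). There exists a single ℝ-linear map T : ℝ⁶ → ℝ⁶ such that for every exactly balanced voltage V ∈ ℂ³ (i.e., V_2 = γV_1, V_3 = γ²V_1) and every delta current vector I ∈ ℂ³, the real/imaginary parts of the bus withdrawal powers S^b_φ = V_φ·conj((ΛᵀI)_φ) equal T applied to the real/imaginary parts of the device powers S^d_φ = (ΛV)_φ·conj(I_φ). In particular, under exact voltage balance the bus withdrawal powers of a delta-connected device depend only on its consumed powers S^d and not otherwise on V_1 or I. -/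

import Mathlib

open Matrix Complex

/-- γ = exp(−2πi/3). -/
noncomputable def gammaRot : ℂ := Complex.exp (-(2 * Real.pi * Complex.I) / 3)

/-- The matrix Λ with rows (1,−1,0), (0,1,−1), (−1,0,1). -/
def deltaLambda : Matrix (Fin 3) (Fin 3) ℂ := !![1, -1, 0; 0, 1, -1; -1, 0, 1]

/-- The 6-dimensional real vector `(Re S₁, Im S₁, Re S₂, Im S₂, Re S₃, Im S₃)`
associated with a complex triple `S ∈ ℂ³`. -/
def toReal6 (S : Fin 3 → ℂ) : Fin 6 → ℝ :=
  ![(S 0).re, (S 0).im, (S 1).re, (S 1).im, (S 2).re, (S 2).im]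

lemma gammaRot_pow_three : gammaRot ^ 3 = 1 := by
  rw [gammaRot, ← Complex.exp_nat_mul, Complex.exp_eq_one_iff]
  exact ⟨-1, by push_cast; ring⟩

lemma one_sub_gammaRot_ne_zero : 1 - gammaRot ≠ 0 := by
  intro h
  obtain ⟨n, hn⟩ := Complex.exp_eq_one_iff.mp (sub_eq_zero.mp h).symm
  have h₁ : ((3 * n + 1 : ℤ) : ℂ) * (2 * Real.pi * Complex.I) = 0 := by
    push_cast
    linear_combination -3 * hn
  have h₂ : 3 * n + 1 = 0 := by
    exact_mod_cast (mul_eq_zero.mp h₁).resolve_right Complex.two_pi_I_ne_zero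
  omega

/-- The ℝ-linear map from `ℝ⁶` to `ℂ³` inverse to `toReal6`. -/
noncomputable def ofReal6 : (Fin 6 → ℝ) →ₗ[ℝ] (Fin 3 → ℂ) where
  toFun x := ![⟨x 0, x 1⟩, ⟨x 2, x 3⟩, ⟨x 4, x 5⟩]
  map_add' x y := by
    ext i
    fin_cases i <;> simp [Complex.ext_iff]
  map_smul' c x := by
    ext i
    fin_cases i <;> simp [Complex.ext_iff]

/-- `toReal6` as an ℝ-linear map. -/
def toReal6Lin : (Fin 3 → ℂ) →ₗ[ℝ] (Fin 6 → ℝ) where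
  toFun := toReal6
  map_add' x y := by
    ext i
    fin_cases i <;> simp [toReal6]
  map_smul' c x := by
    ext i
    fin_cases i <;> simp [toReal6]

lemma ofReal6_toReal6 (S : Fin 3 → ℂ) : ofReal6 (toReal6 S) = S := by
  ext i
  fin_cases i <;> simp [ofReal6, toReal6]

/-- The complex matrix taking device powers to bus withdrawal powers at balanced voltage. -/
noncomputable def deviceToBus : Matrix (Fin 3) (Fin 3) ℂ :=
  (1 - gammaRot)⁻¹ • !![1, 0, -gammaRot; -gammaRot, 1, 0; 0, -gammaRot, 1]

lemma bus_power_eq_deviceToBus_mulVec (V Iv : Fin 3 → ℂ)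
    (h₁ : V 1 = gammaRot * V 0) (h₂ : V 2 = gammaRot ^ 2 * V 0) :
    (fun φ => V φ * (starRingEnd ℂ) ((deltaLambda.transpose.mulVec Iv) φ))
      = deviceToBus.mulVec (fun φ => (deltaLambda.mulVec V) φ * (starRingEnd ℂ) (Iv φ)) := by
  have hγ := gammaRot_pow_three
  have hne := one_sub_gammaRot_ne_zero
  rw [deviceToBus, Matrix.smul_mulVec]
  ext φ
  rw [Pi.smul_apply, smul_eq_mul, eq_inv_mul_iff_mul_eq₀ hne]
  fin_cases φ <;>
    simp [deltaLambda, Matrix.mulVec, dotProduct, Fin.sum_univ_three, h₁, h₂]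
  · linear_combination V 0 * (starRingEnd ℂ) (Iv 2) * hγ
  · ring
  · linear_combination -V 0 * (starRingEnd ℂ) (Iv 2) * hγ

/-- There is a single ℝ-linear map `T : ℝ⁶ → ℝ⁶` such that for every exactly balanced
voltage `V ∈ ℂ³` and every delta current vector `Iv ∈ ℂ³`, the real/imaginary parts of
the bus withdrawal powers `Sb φ = V φ · conj((Λᵀ Iv) φ)` equal `T` applied to the
real/imaginary parts of the device powers `Sd φ = (Λ V) φ · conj(Iv φ)`. In particular,
under exact voltage balance the bus withdrawal powers of a delta-connected device depend
only on its consumed powers `Sd`. -/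
theorem delta_bus_power_linear_in_device_power :
    ∃ T : (Fin 6 → ℝ) →ₗ[ℝ] (Fin 6 → ℝ),
      ∀ V Iv : Fin 3 → ℂ,
        V 1 = gammaRot * V 0 → V 2 = gammaRot ^ 2 * V 0 →
        toReal6 (fun φ => V φ * (starRingEnd ℂ) ((deltaLambda.transpose.mulVec Iv) φ))
          = T (toReal6 (fun φ => (deltaLambda.mulVec V) φ * (starRingEnd ℂ) (Iv φ))) := by
  refine ⟨toReal6Lin ∘ₗ deviceToBus.mulVecLin.restrictScalars ℝ ∘ₗ ofReal6, ?_⟩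
  intro V Iv h₁ h₂
  rw [bus_power_eq_deviceToBus_mulVec V Iv h₁ h₂]
  simp only [LinearMap.comp_apply, ofReal6_toReal6]
  rfl
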